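/- Haiman's conjecture: For 2 ≤ k < l < n, let w_{k,l} ∈ S_n be the permutation [1,...,k−2, k+1,...,l+1, k−1, k, l+2,...,n] (with reduced word s_k s_{k-1} s_{k+1} s_k ⋯ s_l s_{l-1}). Then the Kazhdan–Lusztig polynomial P_{e, w_{k,l}} equals the q-Fibonacci polynomial F_{l-k+1}(q), where F_0 = F_1 = 1 and F_m = F_{m-1} + q F_{m-2}. -/

import Mathlib

open Polynomial

/-- The simple transposition `s_i = (i, i+1)` (1-based) in `S_n`, acting on `Fin n`
(0-based positions `i-1` and `i`); equals `1` if `i` is out of range. -/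
def gen (n : ℕ) (i : ℕ) : Equiv.Perm (Fin n) :=
  if h : 1 ≤ i ∧ i < n then Equiv.swap ⟨i - 1, by omega⟩ ⟨i, h.2⟩ else 1

/-- Product of the word `l` of generator indices. -/
def wordProd (n : ℕ) (l : List ℕ) : Equiv.Perm (Fin n) :=
  (l.map (gen n)).prod

/-- Coxeter length of `w ∈ S_n`. -/
noncomputable def len (n : ℕ) (w : Equiv.Perm (Fin n)) : ℕ :=
  sInf {r | ∃ l : List ℕ, (∀ i ∈ l, 1 ≤ i ∧ i < n) ∧ wordProd n l = w ∧ l.length = r}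

/-- `l` is a reduced word for `w`. -/
def IsReducedWord (n : ℕ) (w : Equiv.Perm (Fin n)) (l : List ℕ) : Prop :=
  (∀ i ∈ l, 1 ≤ i ∧ i < n) ∧ wordProd n l = w ∧ l.length = len n w

/-- Bruhat-Chevalley order: `x ≤ w` iff every reduced word for `w` contains a
subword whose product is `x`. -/
def Bruhat (n : ℕ) (x w : Equiv.Perm (Fin n)) : Prop :=
  ∀ l, IsReducedWord n w l → ∃ t, t.Sublist l ∧ wordProd n t = x

/-- `w` is 321-avoiding: no `i < j < k` with `w i > w j > w k`. -/
def Avoids321 (n : ℕ) (w : Equiv.Perm (Fin n)) : Prop :=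
  ¬ ∃ i j k : Fin n, i < j ∧ j < k ∧ w j < w i ∧ w k < w j

/-- Product of the subword of `l` selected by the mask `S` (set of selected positions). -/
def maskProd (n : ℕ) (l : List ℕ) (S : Finset ℕ) : Equiv.Perm (Fin n) :=
  wordProd n (((List.range l.length).filter (fun j => decide (j ∈ S))).map (fun j => l.getD j 0))

/-- Position `j` of the word `l` is a defect of the mask `S`. -/
noncomputable def IsDefect (n : ℕ) (l : List ℕ) (S : Finset ℕ) (j : ℕ) : Prop :=
  len n (maskProd n (l.take j) S * gen n (l.getD j 0)) < len n (maskProd n (l.take j) S)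

/-- The defect set `D(σ)` of the mask `S` on the word `l`. -/
noncomputable def defectSet (n : ℕ) (l : List ℕ) (S : Finset ℕ) : Finset ℕ :=
  (Finset.range l.length).filter (fun j =>
    len n (maskProd n (l.take j) S * gen n (l.getD j 0)) < len n (maskProd n (l.take j) S))

/-- Deodhar's defect generating polynomial `P_x(a) = Σ_{σ : π(w^σ) = x} q^{|D(σ)|}`. -/
noncomputable def defPoly (n : ℕ) (l : List ℕ) (x : Equiv.Perm (Fin n)) : Polynomial ℤ :=
  ∑ S ∈ (Finset.range l.length).powerset,
    if maskProd n l S = x then (X : Polynomial ℤ) ^ (defectSet n l S).card else 0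


/-- The word `s_k s_{k-1} s_{k+1} s_k ⋯ s_l s_{l-1}` for `w_{k,l}`. -/
def wklWord (k l : ℕ) : List ℕ :=
  (List.range (l - k + 1)).flatMap (fun m => [k + m, k + m - 1])

/-- q-Fibonacci polynomials: `F_0 = F_1 = 1`, `F_m = F_{m-1} + q F_{m-2}`. -/
noncomputable def qFib : ℕ → Polynomial ℤ
  | 0 => 1
  | 1 => 1
  | (m + 2) => qFib (m + 1) + X * qFib m

def Valid (n : ℕ) (l : List ℕ) : Prop := ∀ i ∈ l, 1 ≤ i ∧ i < n

theorem gen_succ (n i : ℕ) (h : i + 1 < n) :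
    gen n (i+1) = Equiv.swap ⟨i, by omega⟩ ⟨i+1, h⟩ := by
  unfold gen
  rw [dif_pos ⟨by omega, h⟩]
  rfl

theorem gen_sq (n i : ℕ) : gen n i * gen n i = 1 := by
  unfold gen
  split_ifs
  · exact Equiv.swap_mul_self _ _
  · simp

theorem mul_gen_gen (n i : ℕ) (x : Equiv.Perm (Fin n)) : x * gen n i * gen n i = x := by
  rw [mul_assoc, gen_sq, mul_one]

theorem wordProd_append (n : ℕ) (l m : List ℕ) :
    wordProd n (l ++ m) = wordProd n l * wordProd n m := by
  simp [wordProd]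

theorem wordProd_single (n i : ℕ) : wordProd n [i] = gen n i := by
  simp [wordProd]

theorem exists_word (n : ℕ) (w : Equiv.Perm (Fin n)) :
    ∃ l, Valid n l ∧ wordProd n l = w := by
  rcases n with _ | n
  · exact ⟨[], by simp [Valid], Subsingleton.elim _ _⟩
  · have hw : w ∈ Submonoid.closure (Set.range fun i : Fin n ↦ Equiv.swap i.castSucc i.succ) := by
      rw [Equiv.Perm.mclosure_swap_castSucc_succ]; trivial
    induction hw using Submonoid.closure_induction with
    | mem x hx =>
      obtain ⟨i, rfl⟩ := hx
      refine ⟨[i.1+1], by simp [Valid], ?_⟩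
      rw [wordProd_single, gen_succ _ _ (by omega)]
      rfl
    | one => exact ⟨[], by simp [Valid], by simp [wordProd]⟩
    | mul x y _ _ hx hy =>
      obtain ⟨l, hl, rfl⟩ := hx
      obtain ⟨m, hm, rfl⟩ := hy
      refine ⟨l ++ m, ?_, wordProd_append _ _ _⟩
      intro i hi
      rcases List.mem_append.1 hi with h | h
      · exact hl i h
      · exact hm i h

theorem len_le (n : ℕ) (l : List ℕ) (hl : Valid n l) : len n (wordProd n l) ≤ l.length :=
  Nat.sInf_le ⟨l, hl, rfl, rfl⟩

theorem exists_reduced (n : ℕ) (w : Equiv.Perm (Fin n)) : ∃ l, IsReducedWord n w l := by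
  obtain ⟨l, hl, hw⟩ := exists_word n w
  have := Nat.sInf_mem (s := {r | ∃ l : List ℕ, (∀ i ∈ l, 1 ≤ i ∧ i < n) ∧ wordProd n l = w ∧ l.length = r})
    ⟨l.length, l, hl, hw, rfl⟩
  obtain ⟨m, h1, h2, h3⟩ := this
  exact ⟨m, h1, h2, h3⟩

theorem valid_sub {n : ℕ} {l m : List ℕ} (hl : Valid n l) (h : m.Sublist l) : Valid n m :=
  fun i hi => hl i (h.subset hi)

theorem swap_adj_lt {n : ℕ} (i : ℕ) (h : i + 1 < n) (a b : Fin n) (hab : a < b)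
    (hne : ¬ (a.1 = i ∧ b.1 = i + 1)) : gen n (i+1) a < gen n (i+1) b := by
  rw [gen_succ _ _ h, Equiv.swap_apply_def, Equiv.swap_apply_def]
  simp only [Fin.ext_iff, Fin.lt_def] at *
  split_ifs <;> simp <;> omega

theorem exchange (n : ℕ) (l : List ℕ) : Valid n l → ∀ a b : Fin n, a < b →
    wordProd n l b < wordProd n l a →
    ∃ l', l'.Sublist l ∧ l'.length + 1 = l.length ∧
      wordProd n l' = wordProd n l * Equiv.swap a b := by
  induction l using List.reverseRecOn with
  | nil =>
    intro _ a b hab h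
    simp [wordProd] at h
    exact absurd h (not_lt.2 hab.le)
  | append_singleton l i ih =>
    intro hv a b hab h
    obtain ⟨h1, h2⟩ := hv i (by simp)
    obtain ⟨i, rfl⟩ : ∃ j, i = j + 1 := ⟨i - 1, by omega⟩
    have hv' : Valid n l := fun j hj => hv j (by simp [hj])
    rw [wordProd_append, wordProd_single] at h ⊢
    by_cases hc : a.1 = i ∧ b.1 = i + 1
    · refine ⟨l, List.sublist_append_left _ _, by simp, ?_⟩
      have : Equiv.swap a b = gen n (i+1) := by
        rw [gen_succ _ _ h2]
        congr 1 <;> ext <;> simp [hc]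
      rw [this, mul_gen_gen]
    · have hlt := swap_adj_lt i h2 a b hab hc
      obtain ⟨l', hs, hlen, hp⟩ := ih hv' _ _ hlt h
      refine ⟨l' ++ [i+1], hs.append_right _, by simp [hlen], ?_⟩
      rw [wordProd_append, wordProd_single, hp, mul_assoc, mul_assoc, Equiv.swap_mul_eq_mul_swap]
      congr 2
      have : (gen n (i+1))⁻¹ = gen n (i+1) := by
        rw [inv_eq_iff_mul_eq_one, gen_sq]
      rw [this, ← Equiv.Perm.mul_apply, ← Equiv.Perm.mul_apply, gen_sq]
      simp

theorem len_swap_lt (n : ℕ) (w : Equiv.Perm (Fin n)) (a b : Fin n) (hab : a < b)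
    (h : w b < w a) : len n (w * Equiv.swap a b) < len n w := by
  obtain ⟨l, hv, rfl, hl⟩ := exists_reduced n w
  obtain ⟨l', hs, hlen, hp⟩ := exchange n l hv a b hab h
  rw [← hp, ← hl]
  have := len_le n l' (valid_sub hv hs)
  omega

theorem len_mul_gen_le (n i : ℕ) (h1 : 1 ≤ i) (h2 : i < n) (w : Equiv.Perm (Fin n)) :
    len n (w * gen n i) ≤ len n w + 1 := by
  obtain ⟨l, hv, rfl, hl⟩ := exists_reduced n w
  rw [← hl, ← wordProd_single, ← wordProd_append]
  refine (len_le n _ ?_).trans (by simp)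
  intro j hj
  rcases List.mem_append.1 hj with h | h
  · exact hv j h
  · simp at h; subst h; exact ⟨h1, h2⟩

theorem asc_of (n i : ℕ) (h : i + 1 < n) (w : Equiv.Perm (Fin n))
    (hw : w ⟨i, by omega⟩ < w ⟨i+1, h⟩) : len n (w * gen n (i+1)) = len n w + 1 := by
  have h1 := len_swap_lt n (w * gen n (i+1)) ⟨i, by omega⟩ ⟨i+1, h⟩ (by simp [Fin.lt_def])
    (by rw [gen_succ _ _ h]; simpa using hw)
  rw [← gen_succ, mul_gen_gen] at h1
  have := len_mul_gen_le n (i+1) (by omega) h w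
  omega

theorem desc_of (n i : ℕ) (h : i + 1 < n) (w : Equiv.Perm (Fin n))
    (hw : w ⟨i+1, h⟩ < w ⟨i, by omega⟩) : len n w = len n (w * gen n (i+1)) + 1 := by
  have := asc_of n i h (w * gen n (i+1)) (by rw [gen_succ _ _ h]; simpa using hw)
  rwa [mul_gen_gen] at this

theorem asc_or (n i : ℕ) (h : i + 1 < n) (w : Equiv.Perm (Fin n)) :
    (len n (w * gen n (i+1)) = len n w + 1 ∧ w ⟨i, by omega⟩ < w ⟨i+1, h⟩) ∨
    (len n w = len n (w * gen n (i+1)) + 1 ∧ w ⟨i+1, h⟩ < w ⟨i, by omega⟩) := by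
  rcases lt_trichotomy (w ⟨i, by omega⟩) (w ⟨i+1, h⟩) with h1 | h1 | h1
  · exact Or.inl ⟨asc_of n i h w h1, h1⟩
  · have := w.injective h1
    simp at this
  · exact Or.inr ⟨desc_of n i h w h1, h1⟩

/-- elementary Bruhat step -/
def BStep (n : ℕ) (x y : Equiv.Perm (Fin n)) : Prop :=
  ∃ a b : Fin n, a < b ∧ y b < y a ∧ x = y * Equiv.swap a b

def BLe (n : ℕ) (x y : Equiv.Perm (Fin n)) : Prop := Relation.ReflTransGen (BStep n) x y

theorem bstep_gen {n i : ℕ} (h : i + 1 < n) (w : Equiv.Perm (Fin n))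
    (hw : len n (w * gen n (i+1)) = len n w + 1) : BStep n w (w * gen n (i+1)) := by
  rcases asc_or n i h w with h1 | h1
  · refine ⟨⟨i, by omega⟩, ⟨i+1, h⟩, by simp [Fin.lt_def], ?_, ?_⟩
    · rw [gen_succ _ _ h]; simpa using h1.2
    · rw [← gen_succ, mul_gen_gen]
  · omega

theorem ble_lift {n i : ℕ} (h : i + 1 < n) (x w : Equiv.Perm (Fin n)) (hx : BLe n x w) :
    BLe n (x * gen n (i+1)) (w * gen n (i+1)) ∨ BLe n (x * gen n (i+1)) w := by
  induction hx using Relation.ReflTransGen.head_induction_on with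
  | refl => exact Or.inl Relation.ReflTransGen.refl
  | head hxy hyw ih =>
    rename_i x y
    obtain ⟨a, b, hab, hlt, rfl⟩ := hxy
    by_cases hc : a.1 = i ∧ b.1 = i + 1
    · right
      have : Equiv.swap a b = gen n (i+1) := by
        rw [gen_succ _ _ h]
        congr 1 <;> ext <;> simp [hc]
      rw [this, mul_gen_gen]
      exact hyw
    · have key : BStep n (y * Equiv.swap a b * gen n (i+1)) (y * gen n (i+1)) := by
        refine ⟨_, _, swap_adj_lt i h a b hab hc, ?_, ?_⟩
        · rw [← Equiv.Perm.mul_apply, ← Equiv.Perm.mul_apply, mul_gen_gen]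
          exact hlt
        · rw [mul_assoc, mul_assoc, Equiv.swap_mul_eq_mul_swap]
          have : (gen n (i+1))⁻¹ = gen n (i+1) := by
            rw [inv_eq_iff_mul_eq_one, gen_sq]
          rw [this]
      rcases ih with ih | ih
      · exact Or.inl (Relation.ReflTransGen.head key ih)
      · exact Or.inr (Relation.ReflTransGen.head key ih)

theorem ble_sub (n : ℕ) (x w : Equiv.Perm (Fin n)) (hx : BLe n x w) :
    ∀ l, Valid n l → wordProd n l = w → ∃ t, t.Sublist l ∧ wordProd n t = x := by
  induction hx using Relation.ReflTransGen.head_induction_on with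
  | refl => exact fun l _ h => ⟨l, List.Sublist.refl _, h⟩
  | head hxy hyw ih =>
    intro l hv hl
    obtain ⟨t, ht, rfl⟩ := ih l hv hl
    obtain ⟨a, b, hab, hlt, rfl⟩ := hxy
    obtain ⟨l', hs, _, hp⟩ := exchange n t (valid_sub hv ht) a b hab hlt
    exact ⟨l', hs.trans ht, hp⟩

theorem bruhat_of_ble {n : ℕ} {x w : Equiv.Perm (Fin n)} (hx : BLe n x w) : Bruhat n x w :=
  fun l hl => ble_sub n x w hx l hl.1 hl.2.1

theorem bruhat_len {n : ℕ} {x w : Equiv.Perm (Fin n)} (h : Bruhat n x w) (hne : x ≠ w) :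
    len n x < len n w := by
  obtain ⟨l, hl⟩ := exists_reduced n w
  obtain ⟨t, ht, rfl⟩ := h l hl
  have h1 := len_le n t (valid_sub hl.1 ht)
  have h2 := ht.length_le
  rcases h2.lt_or_eq with h3 | h3
  · have := hl.2.2; omega
  · exact absurd (ht.eq_of_length h3 ▸ hl.2.1) hne

theorem len_one (n : ℕ) : len n 1 = 0 := by
  have := len_le n [] (by simp [Valid])
  simpa [wordProd] using this

theorem bruhat_one {n : ℕ} {x : Equiv.Perm (Fin n)} (h : Bruhat n x 1) : x = 1 := by
  by_contra hne
  have := bruhat_len h hne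
  rw [len_one] at this
  omega

/-- right multiplication by `1 + T_s` on coefficients -/
noncomputable def hstep (n i : ℕ) (f : Equiv.Perm (Fin n) → Polynomial ℤ)
    (x : Equiv.Perm (Fin n)) : Polynomial ℤ :=
  if len n x < len n (x * gen n i) then f x + X * f (x * gen n i)
  else X * f x + f (x * gen n i)

theorem rsum_step (n : ℕ)
    (R : Equiv.Perm (Fin n) → Equiv.Perm (Fin n) → Polynomial ℤ)
    (hRrec : ∀ (x w : Equiv.Perm (Fin n)) (i : ℕ), 1 ≤ i → i < n →
      len n (w * gen n i) < len n w →
        (len n (x * gen n i) < len n x →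
          R x w = R (x * gen n i) (w * gen n i)) ∧
        (len n x < len n (x * gen n i) →
          R x w = X * R (x * gen n i) (w * gen n i) + (X - 1) * R x (w * gen n i)))
    (i : ℕ) (h : i + 1 < n) (f : Equiv.Perm (Fin n) → Polynomial ℤ)
    (x : Equiv.Perm (Fin n)) :
    ∑ y, R x y * hstep n (i+1) f y =
      (if len n x < len n (x * gen n (i+1)) then X else 1) *
        ∑ y, (R x y + R (x * gen n (i+1)) y) * f y := by
  have e1 : ∀ y, hstep n (i+1) f y =
      (if len n y < len n (y * gen n (i+1)) then 1 else X) * f y +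
      (if len n y < len n (y * gen n (i+1)) then X else 1) * f (y * gen n (i+1)) := by
    intro y; unfold hstep; split_ifs <;> ring
  have e2 : ∑ y, R x y * ((if len n y < len n (y * gen n (i+1)) then X else 1) *
        f (y * gen n (i+1))) =
      ∑ y, R x (y * gen n (i+1)) * ((if len n y < len n (y * gen n (i+1)) then 1 else X) *
        f y) := by
    rw [← Equiv.sum_comp (Equiv.mulRight (gen n (i+1)))]
    refine Finset.sum_congr rfl fun y _ => ?_
    simp only [Equiv.coe_mulRight, mul_gen_gen]
    rcases asc_or n i h y with ⟨h1, -⟩ | ⟨h1, -⟩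
    · rw [if_neg (by omega), if_pos (by omega)]
    · rw [if_pos (by omega), if_neg (by omega)]
  simp only [e1, mul_add, Finset.sum_add_distrib]
  rw [e2, ← Finset.sum_add_distrib, Finset.mul_sum]
  refine Finset.sum_congr rfl fun y _ => ?_
  have r1 := hRrec x y (i+1) (by omega) h
  have r2 := hRrec (x * gen n (i+1)) y (i+1) (by omega) h
  have r3 := hRrec x (y * gen n (i+1)) (i+1) (by omega) h
  simp only [mul_gen_gen] at r1 r2 r3
  rcases asc_or n i h x with ⟨hx, -⟩ | ⟨hx, -⟩ <;>
  rcases asc_or n i h y with ⟨hy, -⟩ | ⟨hy, -⟩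
  · rw [if_pos (by omega), if_pos (by omega), (r3 (by omega)).2 (by omega)]; ring
  · rw [if_neg (by omega), if_pos (by omega), (r2 (by omega)).1 (by omega)]; ring
  · rw [if_pos (by omega), if_neg (by omega), (r3 (by omega)).1 (by omega)]; ring
  · rw [if_neg (by omega), if_neg (by omega), (r2 (by omega)).2 (by omega),
      (r1 (by omega)).1 (by omega)]; ring

/-- bar invariance of weight `N` -/
def BarInv (n N : ℕ) (R : Equiv.Perm (Fin n) → Equiv.Perm (Fin n) → Polynomial ℤ)
    (f : Equiv.Perm (Fin n) → Polynomial ℤ) : Prop :=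
  ∀ t : ℚ, t ≠ 0 → ∀ x, aeval t⁻¹ (f x) * t ^ N = t ^ (len n x) * aeval t (∑ y, R x y * f y)

theorem barInv_step (n N : ℕ)
    (R : Equiv.Perm (Fin n) → Equiv.Perm (Fin n) → Polynomial ℤ)
    (hRrec : ∀ (x w : Equiv.Perm (Fin n)) (i : ℕ), 1 ≤ i → i < n →
      len n (w * gen n i) < len n w →
        (len n (x * gen n i) < len n x →
          R x w = R (x * gen n i) (w * gen n i)) ∧
        (len n x < len n (x * gen n i) →
          R x w = X * R (x * gen n i) (w * gen n i) + (X - 1) * R x (w * gen n i)))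
    (i : ℕ) (h : i + 1 < n) (f : Equiv.Perm (Fin n) → Polynomial ℤ)
    (hf : BarInv n N R f) : BarInv n (N+1) R (hstep n (i+1) f) := by
  intro t ht x
  rw [rsum_step n R hRrec i h]
  have a1 := hf t ht x
  have a2 := hf t ht (x * gen n (i+1))
  simp only [add_mul, Finset.sum_add_distrib]
  unfold hstep
  rcases asc_or n i h x with ⟨hx, -⟩ | ⟨hx, -⟩
  · rw [if_pos (by omega), if_pos (by omega)]
    rw [hx] at a2
    simp only [map_add, map_mul, aeval_X] at *
    have : t⁻¹ * t = 1 := inv_mul_cancel₀ ht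
    linear_combination t * a1 + a2 + (aeval t⁻¹) (f (x * gen n (i + 1))) * t ^ N * this
  · rw [if_neg (by omega), if_neg (by omega)]
    rw [hx] at a1 ⊢
    simp only [map_add, map_mul, aeval_X, one_mul] at *
    have : t⁻¹ * t = 1 := inv_mul_cancel₀ ht
    linear_combination a1 + t * a2 + (aeval t⁻¹) (f x) * t ^ N * this

def Fx (n i : ℕ) (x : Equiv.Perm (Fin n)) : Prop := ∀ a : Fin n, i + 2 ≤ a.1 → x a = a

theorem Fx.lt {n i : ℕ} {x : Equiv.Perm (Fin n)} (hx : Fx n i x) (a : Fin n) (ha : a.1 < i + 2) :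
    (x a).1 < i + 2 := by
  by_contra hc
  have := hx (x a) (by omega)
  have := x.injective this
  rw [this] at hc
  omega

theorem fx_one (n i : ℕ) : Fx n i 1 := fun _ _ => rfl

theorem gen_fix {n i : ℕ} (h : i + 1 < n) (a : Fin n) (ha : i + 2 ≤ a.1) :
    gen n (i+1) a = a := by
  rw [gen_succ _ _ h]
  apply Equiv.swap_apply_of_ne_of_ne <;> (simp [Fin.ext_iff]; omega)

theorem Fx.mono {n i : ℕ} {x : Equiv.Perm (Fin n)} (hx : Fx n i x) : Fx n (i+1) x :=
  fun a ha => hx a (by omega)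

theorem Fx.mul_gen {n i : ℕ} {x : Equiv.Perm (Fin n)} (h : i + 1 < n) (hx : Fx n i x) :
    Fx n i (x * gen n (i+1)) := by
  intro a ha
  rw [Equiv.Perm.mul_apply, gen_fix h a ha, hx a ha]

theorem Fx.mul_gen_iff {n i : ℕ} {x : Equiv.Perm (Fin n)} (h : i + 1 < n) :
    Fx n i (x * gen n (i+1)) ↔ Fx n i x :=
  ⟨fun hx => by simpa [mul_gen_gen] using hx.mul_gen h, fun hx => hx.mul_gen h⟩

structure Good (n i N : ℕ) (w : Equiv.Perm (Fin n)) (f : Equiv.Perm (Fin n) → Polynomial ℤ) :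
    Prop where
  supp : ∀ x, f x ≠ 0 → Fx n i x
  ble : ∀ x, f x ≠ 0 → BLe n x w
  deg : ∀ x j, (f x).coeff j ≠ 0 → (x = w ∧ j = 0) ∨ 2 * j + 1 + len n x ≤ N
  top : f w = 1
  wlt : ∀ h : i + 1 < n, w ⟨i, by omega⟩ < w ⟨i+1, h⟩
  len_eq : len n w = N


theorem gs_lo {n i : ℕ} (h : i + 2 < n) : gen n (i+2) ⟨i, by omega⟩ = ⟨i, by omega⟩ := by
  rw [gen_succ _ _ h]
  apply Equiv.swap_apply_of_ne_of_ne <;> (simp [Fin.ext_iff]; try omega)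

theorem gs_mid {n i : ℕ} (h : i + 2 < n) : gen n (i+2) ⟨i+1, by omega⟩ = ⟨i+2, by omega⟩ := by
  rw [gen_succ _ _ h]
  simp

theorem gs_hi {n i : ℕ} (h : i + 2 < n) : gen n (i+2) ⟨i+2, by omega⟩ = ⟨i+1, by omega⟩ := by
  rw [gen_succ _ _ h]
  simp

theorem gt_lo {n i : ℕ} (h : i + 2 < n) : gen n (i+1) ⟨i, by omega⟩ = ⟨i+1, by omega⟩ := by
  rw [gen_succ n i (by omega)]
  simp

theorem gt_mid {n i : ℕ} (h : i + 2 < n) : gen n (i+1) ⟨i+1, by omega⟩ = ⟨i, by omega⟩ := by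
  rw [gen_succ n i (by omega)]
  simp

theorem gt_hi {n i : ℕ} (h : i + 2 < n) : gen n (i+1) ⟨i+2, by omega⟩ = ⟨i+2, by omega⟩ :=
  gen_fix (by omega) _ (by simp)

theorem fx_asc_s {n i : ℕ} (h : i + 2 < n) {x : Equiv.Perm (Fin n)} (hx : Fx n i x) :
    len n (x * gen n (i+2)) = len n x + 1 := by
  apply asc_of n (i+1) h
  rw [hx ⟨i+1+1, h⟩ (by simp)]
  exact hx.lt _ (by simp)

theorem fx_asc_t {n i : ℕ} (h : i + 2 < n) {x : Equiv.Perm (Fin n)} (hx : Fx n i x) :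
    len n (x * gen n (i+2) * gen n (i+1)) = len n x + 2 := by
  rw [asc_of n i (by omega), fx_asc_s h hx]
  rw [Equiv.Perm.mul_apply, Equiv.Perm.mul_apply, gs_lo h, gs_mid h, hx ⟨i+2, h⟩ (by simp)]
  exact hx.lt _ (by simp)

theorem not_fx_s {n i : ℕ} (h : i + 2 < n) {x : Equiv.Perm (Fin n)} (hx : Fx n i x) : ¬ Fx n i (x * gen n (i+2)) := by
  intro hc
  have h1 := hc.lt ⟨i+1, by omega⟩ (by simp)
  rw [Equiv.Perm.mul_apply, gs_mid h, hx ⟨i+2, h⟩ (by simp)] at h1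
  simp at h1

theorem not_fx_st {n i : ℕ} (h : i + 2 < n) {x : Equiv.Perm (Fin n)} (hx : Fx n i x) :
    ¬ Fx n i (x * gen n (i+2) * gen n (i+1)) := by
  rw [Fx.mul_gen_iff (by omega)]
  exact not_fx_s h hx





theorem g_fx {n i : ℕ} (h : i + 2 < n) {f : Equiv.Perm (Fin n) → Polynomial ℤ}
    (hs : ∀ x, f x ≠ 0 → Fx n i x) {x : Equiv.Perm (Fin n)} (hx : Fx n i x) :
    hstep n (i+2) f x = f x := by
  have h0 : f (x * gen n (i+2)) = 0 := by
    by_contra hc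
    exact not_fx_s h hx (hs _ hc)
  have := fx_asc_s h hx
  unfold hstep
  rw [if_pos (by omega), h0]; ring

theorem g_fx_s {n i : ℕ} (h : i + 2 < n) {f : Equiv.Perm (Fin n) → Polynomial ℤ}
    (hs : ∀ x, f x ≠ 0 → Fx n i x) {x : Equiv.Perm (Fin n)} (hx : Fx n i x) :
    hstep n (i+2) f (x * gen n (i+2)) = f x := by
  have h0 : f (x * gen n (i+2)) = 0 := by
    by_contra hc
    exact not_fx_s h hx (hs _ hc)
  have := fx_asc_s h hx
  unfold hstep
  rw [mul_gen_gen, if_neg (by omega), h0]; ring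

theorem hstep_ne {n j : ℕ} {f : Equiv.Perm (Fin n) → Polynomial ℤ} {x : Equiv.Perm (Fin n)}
    (hx : hstep n j f x ≠ 0) : f x ≠ 0 ∨ f (x * gen n j) ≠ 0 := by
  by_contra hc
  push Not at hc
  apply hx
  unfold hstep
  rw [hc.1, hc.2]; simp

theorem g_cases {n i : ℕ} (h : i + 2 < n) {f : Equiv.Perm (Fin n) → Polynomial ℤ}
    (hs : ∀ x, f x ≠ 0 → Fx n i x) {z : Equiv.Perm (Fin n)} (hz : hstep n (i+2) f z ≠ 0) :
    (Fx n i z ∧ hstep n (i+2) f z = f z) ∨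
    (∃ x, z = x * gen n (i+2) ∧ Fx n i x ∧ hstep n (i+2) f z = f x ∧ len n z = len n x + 1 ∧
      len n (z * gen n (i+1)) = len n x + 2) := by
  rcases hstep_ne hz with h1 | h1
  · exact Or.inl ⟨hs _ h1, g_fx h hs (hs _ h1)⟩
  · have hx := hs _ h1
    have e := mul_gen_gen n (i+2) z
    refine Or.inr ⟨z * gen n (i+2), e.symm, hx, ?_, ?_, ?_⟩
    · have := g_fx_s h hs hx
      rwa [e] at this
    · have := fx_asc_s h hx
      rwa [e] at this
    · have := fx_asc_t h hx
      rwa [e] at this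

theorem g_st {n i : ℕ} (h : i + 2 < n) {f : Equiv.Perm (Fin n) → Polynomial ℤ}
    (hs : ∀ x, f x ≠ 0 → Fx n i x) {x : Equiv.Perm (Fin n)} (hx : Fx n i x) :
    hstep n (i+2) f (x * gen n (i+2) * gen n (i+1)) = 0 := by
  by_contra hc
  rcases g_cases h hs hc with ⟨h1, -⟩ | ⟨y, -, hy, -, h1, h2⟩
  · exact not_fx_st h hx h1
  · rw [mul_gen_gen] at h2
    have := fx_asc_s h hx
    have := fx_asc_t h hx
    omega

theorem h_st {n i : ℕ} (h : i + 2 < n) {f : Equiv.Perm (Fin n) → Polynomial ℤ}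
    (hs : ∀ x, f x ≠ 0 → Fx n i x) {x : Equiv.Perm (Fin n)} (hx : Fx n i x) :
    hstep n (i+1) (hstep n (i+2) f) (x * gen n (i+2) * gen n (i+1)) = f x := by
  have h1 := fx_asc_s h hx
  have h2 := fx_asc_t h hx
  rw [hstep, mul_gen_gen, if_neg (by omega), g_st h hs hx, g_fx_s h hs hx]; ring

theorem h_s {n i : ℕ} (h : i + 2 < n) {f : Equiv.Perm (Fin n) → Polynomial ℤ}
    (hs : ∀ x, f x ≠ 0 → Fx n i x) {x : Equiv.Perm (Fin n)} (hx : Fx n i x) :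
    hstep n (i+1) (hstep n (i+2) f) (x * gen n (i+2)) = f x := by
  have h1 := fx_asc_s h hx
  have h2 := fx_asc_t h hx
  rw [hstep, if_pos (by omega), g_st h hs hx, g_fx_s h hs hx]; ring

theorem h_one {n i : ℕ} (h : i + 2 < n) {f : Equiv.Perm (Fin n) → Polynomial ℤ}
    (hs : ∀ x, f x ≠ 0 → Fx n i x) :
    hstep n (i+1) (hstep n (i+2) f) 1 = f 1 + X * f (gen n (i+1)) := by
  have h1 := asc_of n i (by omega) 1 (by simp [Fin.lt_def])
  have h2 := (fx_one n i).mul_gen (i := i) (by omega)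
  rw [hstep, if_pos (by omega), g_fx h hs (fx_one _ _), g_fx h hs h2, one_mul]

theorem ble_step {n i : ℕ} (h : i + 1 < n) {f : Equiv.Perm (Fin n) → Polynomial ℤ}
    {w : Equiv.Perm (Fin n)} (hw : len n (w * gen n (i+1)) = len n w + 1)
    (hf : ∀ x, f x ≠ 0 → BLe n x w) (x : Equiv.Perm (Fin n)) (hx : hstep n (i+1) f x ≠ 0) :
    BLe n x (w * gen n (i+1)) := by
  have hb := bstep_gen h w hw
  rcases hstep_ne hx with h1 | h1
  · exact Relation.ReflTransGen.tail (hf _ h1) hb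
  · rcases ble_lift h _ _ (hf _ h1) with h2 | h2
    · rwa [mul_gen_gen] at h2
    · rw [mul_gen_gen] at h2
      exact Relation.ReflTransGen.tail h2 hb

theorem coeff_cases {p q : Polynomial ℤ} {j : ℕ} (hj : (p + X * q).coeff j ≠ 0) :
    p.coeff j ≠ 0 ∨ ∃ j', j = j' + 1 ∧ q.coeff j' ≠ 0 := by
  by_contra hc
  push Not at hc
  apply hj
  rcases j with _ | j
  · simp [hc.1]
  · simp [hc.1, hc.2 j rfl]

theorem good_step {n i N : ℕ} (h : i + 2 < n) {f : Equiv.Perm (Fin n) → Polynomial ℤ}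
    {w : Equiv.Perm (Fin n)} (hg : Good n i N w f) :
    Good n (i+1) (N+2) (w * gen n (i+2) * gen n (i+1)) (hstep n (i+1) (hstep n (i+2) f)) := by
  have hw : Fx n i w := hg.supp w (by rw [hg.top]; exact one_ne_zero)
  have hs := hg.supp
  have w1 := fx_asc_s h hw
  have w2 := fx_asc_t h hw
  have w3 := asc_of n i (by omega) w (hg.wlt (by omega))
  have hN := hg.len_eq
  have gs : ∀ x, hstep n (i+2) f x ≠ 0 → Fx n (i+1) x := by
    intro x hx
    rcases hstep_ne hx with h1 | h1
    · exact (hs _ h1).mono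
    · exact (Fx.mul_gen_iff h).1 (hs _ h1).mono
  have gd : ∀ z j, (hstep n (i+2) f z).coeff j ≠ 0 →
      (Fx n i z ∧ ((z = w ∧ j = 0) ∨ 2 * j + 1 + len n z ≤ N)) ∨
      (len n (z * gen n (i+1)) = len n z + 1 ∧
        ((z = w * gen n (i+2) ∧ j = 0 ∧ len n z = N + 1) ∨ 2 * j + 1 + len n z ≤ N + 1)) := by
    intro z j hj
    have hz : hstep n (i+2) f z ≠ 0 := by
      intro h0; rw [h0] at hj; simp at hj
    rcases g_cases h hs hz with ⟨h1, h2⟩ | ⟨x, rfl, h1, h2, h3, h4⟩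
    · rw [h2] at hj
      exact Or.inl ⟨h1, hg.deg _ _ hj⟩
    · rw [h2] at hj
      right
      refine ⟨by omega, ?_⟩
      rcases hg.deg _ _ hj with ⟨rfl, h5⟩ | h5
      · exact Or.inl ⟨rfl, h5, by omega⟩
      · right; omega
  have hi : i + 1 < n := by omega
  refine ⟨?_, ?_, ?_, ?_, ?_, by omega⟩
  · intro x hx
    rcases hstep_ne hx with h1 | h1
    · exact gs _ h1
    · intro a ha
      have := gs _ h1 a ha
      rwa [Equiv.Perm.mul_apply, gen_fix hi a (by omega)] at this
  · exact ble_step hi (by omega) (ble_step h w1 hg.ble)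
  · intro z j hj
    unfold hstep at hj
    change (if len n z < len n (z * gen n (i+1)) then
      hstep n (i+2) f z + X * hstep n (i+2) f (z * gen n (i+1)) else
      X * hstep n (i+2) f z + hstep n (i+2) f (z * gen n (i+1))).coeff j ≠ 0 at hj
    have e := mul_gen_gen n (i+1) z
    rcases asc_or n i hi z with ⟨hz, -⟩ | ⟨hz, -⟩
    · right
      rw [if_pos (by omega)] at hj
      rcases coeff_cases hj with h1 | ⟨j, rfl, h1⟩
      · rcases gd _ _ h1 with ⟨-, ⟨rfl, h2⟩ | h2⟩ | ⟨-, ⟨-, h2⟩ | h2⟩ <;> omega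
      · rcases gd _ _ h1 with ⟨-, ⟨h2, h3⟩ | h2⟩ | ⟨h2, -⟩
        · rw [h2] at e hz; rw [e] at w3; omega
        · omega
        · rw [e] at h2; omega
    · rw [if_neg (by omega), add_comm] at hj
      rcases coeff_cases hj with h1 | ⟨j, rfl, h1⟩
      · rcases gd _ _ h1 with ⟨-, ⟨h2, h3⟩ | h2⟩ | ⟨-, ⟨h2, h3, h4⟩ | h2⟩
        · rw [h2] at hz; omega
        · omega
        · left; rw [← h2, e]; exact ⟨rfl, h3⟩
        · omega
      · right
        rcases gd _ _ h1 with ⟨-, ⟨rfl, h3⟩ | h2⟩ | ⟨h2, -⟩ <;> omega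
  · rw [h_st h hs hw, hg.top]
  · intro _
    simp only [Equiv.Perm.mul_apply]
    rw [gt_mid h, gt_hi h, gs_lo h, gs_hi h]
    exact hg.wlt hi

open scoped Classical in
noncomputable def FF (n k : ℕ) : ℕ → Equiv.Perm (Fin n) → Polynomial ℤ
  | 0 => fun x => if x = 1 then 1 else 0
  | m + 1 => hstep n (k+m+1) (hstep n (k+m+2) (FF n k m))

def WW (n k m : ℕ) : Equiv.Perm (Fin n) :=
  wordProd n ((List.range m).flatMap (fun m => [k + 2 + m, k + 2 + m - 1]))

theorem WW_succ (n k m : ℕ) :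
    WW n k (m+1) = WW n k m * gen n (k+m+2) * gen n (k+m+1) := by
  unfold WW
  rw [List.range_succ, List.flatMap_append, wordProd_append]
  have e1 : k + 2 + m = k + m + 2 := by omega
  have e2 : k + 2 + m - 1 = k + m + 1 := by omega
  rw [List.flatMap_singleton, e1, Nat.add_sub_cancel (m := 1) (n := k + m + 1)]
  simp [wordProd, mul_assoc]

theorem good_FF (n k m : ℕ) (h : k + m + 1 < n) : Good n (k+m) (2*m) (WW n k m) (FF n k m) := by
  induction m with
  | zero =>
    have hW : WW n k 0 = 1 := by simp [WW, wordProd]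
    have hx : ∀ x, FF n k 0 x ≠ 0 → x = 1 := by
      intro x hx
      by_contra hc
      exact hx (by simp [FF, hc])
    rw [hW]
    refine ⟨?_, ?_, ?_, by simp [FF], ?_, by simp [len_one]⟩
    · intro x h1; rw [hx x h1]; exact fx_one _ _
    · intro x h1; rw [hx x h1]; exact Relation.ReflTransGen.refl
    · intro x j h1
      have : x = 1 := hx x (by intro h0; rw [h0] at h1; simp at h1)
      subst this
      left
      refine ⟨rfl, ?_⟩
      by_contra hj
      apply h1
      simp [FF, coeff_one, hj]
    · intro _; simp [Fin.lt_def]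
  | succ m ih =>
    rw [WW_succ]
    exact good_step (by omega) (ih (by omega))

theorem FF_fib (n k m : ℕ) (h : k + m + 2 < n) :
    FF n k (m+1) 1 = qFib (m+1) ∧ FF n k (m+1) (gen n (k+m+2)) = qFib m := by
  induction m with
  | zero =>
    have hs := (good_FF n k 0 (by omega)).supp
    constructor
    · have := h_one (i := k + 0) (by omega) hs
      rw [FF, this]
      have hne : gen n (k+0+1) ≠ 1 := by
        rw [gen_succ n _ (by omega)]
        simp [Equiv.swap_eq_one_iff]
      simp only [FF, if_neg hne]
      simp [qFib]
    · have := h_s (i := k + 0) (by omega) hs (fx_one _ _)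
      rw [one_mul] at this
      rw [FF, this]
      simp [FF, qFib]
  | succ m ih =>
    have hs := (good_FF n k (m+1) (by omega)).supp
    obtain ⟨i1, i2⟩ := ih (by omega)
    constructor
    · have := h_one (i := k + (m+1)) (by omega) hs
      rw [FF, this, i1, qFib]
      congr 2
    · have := h_s (i := k + (m+1)) (by omega) hs (fx_one _ _)
      rw [one_mul] at this
      rw [FF, this, i1]

theorem barInv_FF (n : ℕ)
    (R : Equiv.Perm (Fin n) → Equiv.Perm (Fin n) → Polynomial ℤ)
    (hR0 : ∀ x w : Equiv.Perm (Fin n), ¬ Bruhat n x w → R x w = 0)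
    (hR1 : ∀ w : Equiv.Perm (Fin n), R w w = 1)
    (hRrec : ∀ (x w : Equiv.Perm (Fin n)) (i : ℕ), 1 ≤ i → i < n →
      len n (w * gen n i) < len n w →
        (len n (x * gen n i) < len n x →
          R x w = R (x * gen n i) (w * gen n i)) ∧
        (len n x < len n (x * gen n i) →
          R x w = X * R (x * gen n i) (w * gen n i) + (X - 1) * R x (w * gen n i)))
    (k m : ℕ) (h : k + m + 1 < n) : BarInv n (2*m) R (FF n k m) := by
  induction m with
  | zero =>
    intro t ht x
    by_cases hx : x = 1
    · subst hx
      simp [FF, len_one, hR1]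
    · have : R x 1 = 0 := hR0 _ _ fun hb => hx (bruhat_one hb)
      simp [FF, hx, this]
  | succ m ih =>
    exact barInv_step n _ R hRrec _ (by omega) _
      (barInv_step n _ R hRrec (k+m+1) (by omega) _ (ih (by omega)))

theorem reflect_eq_of_aeval {p q : Polynomial ℤ} {d : ℕ} (hp : p.natDegree ≤ d)
    (hpq : ∀ t : ℚ, t ≠ 0 → aeval t⁻¹ p * t ^ d = aeval t q) : p.reflect d = q := by
  have hinj : Function.Injective (Polynomial.map (Int.castRingHom ℚ)) :=
    Polynomial.map_injective _ Int.cast_injective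
  apply hinj
  apply Polynomial.eq_of_infinite_eval_eq
  refine Set.Infinite.mono (s := {0}ᶜ) ?_ (Set.Finite.infinite_compl (Set.finite_singleton 0))
  intro t ht
  have ht0 : t ≠ 0 := ht
  have h1 := hpq t ht0
  let _ : Invertible t⁻¹ := invertibleOfNonzero (inv_ne_zero ht0)
  have h2 := eval₂_reflect_mul_pow (Int.castRingHom ℚ) t⁻¹ d p hp
  rw [invOf_eq_inv, inv_inv] at h2
  simp only [Set.mem_ofPred_eq, Polynomial.eval_map]
  have h3 : aeval t q = eval₂ (Int.castRingHom ℚ) t q := rfl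
  have h4 : aeval t⁻¹ p = eval₂ (Int.castRingHom ℚ) t⁻¹ p := rfl
  rw [← h3, ← h1, h4, ← h2, mul_assoc, ← mul_pow, inv_mul_cancel₀ ht0]
  simp

theorem eq_zero_of_reflect {p : Polynomial ℤ} {d : ℕ} (hp : ∀ j, p.coeff j ≠ 0 → 2 * j + 1 ≤ d)
    (h : p.reflect d = p) : p = 0 := by
  ext j
  by_contra hj
  simp only [coeff_zero] at hj
  have h1 := hp j hj
  rw [← h, coeff_reflect, revAt_le (by omega)] at hj
  have := hp _ hj
  omega

open scoped Classical in
/-- Haiman's conjecture: for `2 ≤ k < l < n`,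
`P_{e, w_{k,l}} = F_{l-k+1}(q)`, where `w_{k,l}` has reduced word
`s_k s_{k-1} s_{k+1} s_k ⋯ s_l s_{l-1}`.  The Kazhdan-Lusztig polynomials `P` are
axiomatized via the R-polynomials as in the Kazhdan-Lusztig defining properties. -/
theorem stmt14 (n : ℕ)
    (R P : Equiv.Perm (Fin n) → Equiv.Perm (Fin n) → Polynomial ℤ)
    (hR0 : ∀ x w : Equiv.Perm (Fin n), ¬ Bruhat n x w → R x w = 0)
    (hR1 : ∀ w : Equiv.Perm (Fin n), R w w = 1)
    (hRrec : ∀ (x w : Equiv.Perm (Fin n)) (i : ℕ), 1 ≤ i → i < n →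
      len n (w * gen n i) < len n w →
        (len n (x * gen n i) < len n x →
          R x w = R (x * gen n i) (w * gen n i)) ∧
        (len n x < len n (x * gen n i) →
          R x w = X * R (x * gen n i) (w * gen n i) + (X - 1) * R x (w * gen n i)))
    (hP0 : ∀ x w : Equiv.Perm (Fin n), ¬ Bruhat n x w → P x w = 0)
    (hP1 : ∀ w : Equiv.Perm (Fin n), P w w = 1)
    (hPdeg : ∀ x w : Equiv.Perm (Fin n), Bruhat n x w → x ≠ w →
      2 * (P x w).natDegree + 1 + len n x ≤ len n w)
    (hPbar : ∀ x w : Equiv.Perm (Fin n), Bruhat n x w →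
      (P x w).reflect (len n w - len n x) =
        ∑ y : Equiv.Perm (Fin n),
          (if Bruhat n x y ∧ Bruhat n y w then R x y * P y w else 0))
    (k l : ℕ) (h2 : 2 ≤ k) (hkl : k < l) (hln : l < n) :
    P 1 (wordProd n (wklWord k l)) = qFib (l - k + 1) := by
  have hk : k - 2 + 2 = k := by omega
  have hi : (k - 2) + (l - k + 1) + 1 < n := by omega
  have hg := good_FF n (k-2) (l-k+1) hi
  have hb := barInv_FF n R hR0 hR1 hRrec (k-2) (l-k+1) hi
  have hF := (FF_fib n (k-2) (l-k) (by omega)).1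
  have hW : wordProd n (wklWord k l) = WW n (k-2) (l-k+1) := by
    unfold wklWord WW
    rw [hk]
  rw [hW, ← hF]
  generalize WW n (k-2) (l-k+1) = w at *
  generalize FF n (k-2) (l-k+1) = f at *
  have hlw := hg.len_eq
  generalize 2 * (l-k+1) = N at *
  have main : ∀ d x, len n w - len n x ≤ d → P x w = f x := by
    intro d
    induction d using Nat.strong_induction_on with
    | _ d ih =>
    intro x hd
    by_cases hx : Bruhat n x w
    swap
    · rw [hP0 _ _ hx]
      by_contra hc
      exact hx (bruhat_of_ble (hg.ble x (Ne.symm hc)))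
    by_cases hxw : x = w
    · subst hxw; rw [hP1, hg.top]
    have hlt := bruhat_len hx hxw
    have hPb := hPbar x w hx
    have hsum : (∑ y : Equiv.Perm (Fin n),
          (if Bruhat n x y ∧ Bruhat n y w then R x y * P y w else 0)) =
        (∑ y, R x y * f y) + (P x w - f x) := by
      have : P x w - f x = ∑ y, if y = x then P x w - f x else 0 := by simp
      rw [this, ← Finset.sum_add_distrib]
      refine Finset.sum_congr rfl fun y _ => ?_
      have e : (if Bruhat n x y ∧ Bruhat n y w then R x y * P y w else 0) = R x y * P y w := by
        split_ifs with hc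
        · rfl
        · rw [not_and_or] at hc
          rcases hc with hc | hc
          · rw [hR0 _ _ hc, zero_mul]
          · rw [hP0 _ _ hc, mul_zero]
      rw [e]
      by_cases hyx : y = x
      · subst hyx; rw [if_pos rfl, hR1]; ring
      · rw [if_neg hyx, add_zero]
        by_cases hxy : Bruhat n x y
        · have := bruhat_len hxy (Ne.symm hyx)
          rw [ih (len n w - len n y) (by omega) y le_rfl]
        · rw [hR0 _ _ hxy]; ring
    have hfd : ∀ j, (f x).coeff j ≠ 0 → 2 * j + 1 ≤ len n w - len n x := by
      intro j hj
      rcases hg.deg x j hj with ⟨h1, -⟩ | h1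
      · exact absurd h1 hxw
      · omega
    have hfr : (f x).reflect (len n w - len n x) = ∑ y, R x y * f y := by
      apply reflect_eq_of_aeval
      · rw [natDegree_le_iff_coeff_eq_zero]
        intro j hj
        by_contra hc
        have := hfd j hc
        omega
      · intro t ht
        have h1 := hb t ht x
        have h3 : t ^ N = t ^ (len n x) * t ^ (len n w - len n x) := by
          rw [← pow_add]; congr 1; omega
        rw [h3] at h1
        apply mul_left_cancel₀ (pow_ne_zero (len n x) ht)
        rw [← h1]; ring
    have hPd := hPdeg x w hx hxw
    rw [hsum] at hPb
    rw [← sub_eq_zero]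
    apply eq_zero_of_reflect (d := len n w - len n x)
    · intro j hj
      by_cases hc : (f x).coeff j = 0
      · rw [coeff_sub, hc, sub_zero] at hj
        have := le_natDegree_of_ne_zero hj
        omega
      · exact hfd j hc
    · rw [reflect_sub, hPb, hfr]; ring
  exact main _ 1 le_rfl
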